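/- There exist universal constants c ∈ (0, 0.1), C₃, and C₄ such that the following holds. Fix any 1 ≤ k ≤ d and let n ≥ d·k·(C₃·log(d·k + 1))^{C₄}. If X₁, …, X_n are i.i.d. samples from the standard Gaussian N(0, I_d) in ℝ^d, then with probability at least 1 − e^{−c·n}: for every symmetric matrix P ∈ ℝ^{d×d} of rank at most k and Frobenius norm 1, and every subset S ⊆ [n] of size at least (1−c)·n, we have |(1/n)·Σ_{i∈S} ⟨X_i X_iᵀ − I, P⟩| ≤ 0.1, where ⟨A, B⟩ = Tr(Aᵀ B) denotes the trace inner product on matrices. -/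

import Mathlib

open MeasureTheory ProbabilityTheory Matrix Real
open scoped ENNReal

noncomputable section

/-- The Gaussian measure `N(μ, Σ)` on `ℝ^d`, defined via its density w.r.t. Lebesgue measure. -/
def gauss (d : ℕ) (μ : Fin d → ℝ) (S : Matrix (Fin d) (Fin d) ℝ) : Measure (Fin d → ℝ) :=
  volume.withDensity fun x =>
    ENNReal.ofReal ((Real.sqrt ((2 * Real.pi) ^ d * S.det))⁻¹ *
      Real.exp (-(1/2) * ((x - μ) ⬝ᵥ (S⁻¹ *ᵥ (x - μ)))))


/-- The Frobenius norm of a real `d × d` matrix. -/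
def frobNorm {d : ℕ} (M : Matrix (Fin d) (Fin d) ℝ) : ℝ :=
  Real.sqrt (∑ i, ∑ j, (M i j) ^ 2)

/-- The trace inner product `⟨A, B⟩ = Tr(Aᵀ B) = ∑ᵢⱼ Aᵢⱼ Bᵢⱼ`. -/
def tin {d : ℕ} (A B : Matrix (Fin d) (Fin d) ℝ) : ℝ := ∑ i, ∑ j, A i j * B i j


lemma lint_pi {E : Type*} [MeasurableSpace E] (n : ℕ) (μ : Fin n → Measure E)
    [∀ i, SigmaFinite (μ i)] (f : Fin n → E → ℝ≥0∞) (hf : ∀ i, Measurable (f i)) :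
    ∫⁻ x, ∏ i, f i (x i) ∂(Measure.pi μ) = ∏ i, ∫⁻ x, f i x ∂(μ i) := by
  induction n with
  | zero => simp
  | succ n ih =>
    have h := (measurePreserving_piFinSuccAbove μ 0).symm
    rw [← h.map_eq, lintegral_map_equiv]
    simp only [Fin.prod_univ_succ, MeasurableEquiv.piFinSuccAbove_symm_apply]
    simp only [Fin.insertNthEquiv, Fin.zero_succAbove, Equiv.coe_fn_mk, Fin.insertNth_zero', Fin.cons_zero, Fin.cons_succ]
    rw [lintegral_prod_mul (f := f 0) (g := fun x : Fin n → E => ∏ i, f i.succ (x i))]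
    · rw [ih (fun j => μ j.succ) (fun j => f j.succ) (fun j => hf _)]
    · exact (hf 0).aemeasurable
    · exact (Finset.measurable_prod _ fun i _ => (hf _).comp (measurable_pi_apply i)).aemeasurable

/-- one dimensional density -/
def phi (x : ℝ) : ℝ := (√(2 * π))⁻¹ * Real.exp (-(1/2) * x ^ 2)

lemma phi_nonneg (x : ℝ) : 0 ≤ phi x := by unfold phi; positivity

lemma phi_meas : Measurable phi := by unfold phi; fun_prop

lemma one_d (s : ℝ) (hs : s < 1 / 2) :
    ∫⁻ x, ENNReal.ofReal (phi x * Real.exp (s * (x ^ 2 - 1))) =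
      ENNReal.ofReal (Real.exp (-s) * (√(1 - 2 * s))⁻¹) := by
  have e : ∀ x, phi x * Real.exp (s * (x ^ 2 - 1)) =
      ((√(2 * π))⁻¹ * Real.exp (-s)) * Real.exp (-(1/2 - s) * x ^ 2) := by
    intro x
    unfold phi
    rw [mul_assoc, mul_assoc, ← Real.exp_add, ← Real.exp_add]
    congr 2; ring
  simp_rw [e]
  rw [← ofReal_integral_eq_lintegral_ofReal]
  · rw [integral_const_mul, integral_gaussian]
    congr 1
    have h1 : (0:ℝ) < 1 - 2 * s := by linarith
    have h2 : π / (1/2 - s) = (2 * π) / (1 - 2 * s) := by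
      field_simp
    rw [h2, Real.sqrt_div (by positivity)]
    have : √(2 * π) ≠ 0 := by positivity
    field_simp
  · exact (integrable_exp_neg_mul_sq (by linarith)).const_mul _
  · exact Filter.Eventually.of_forall fun x => by positivity

lemma one_d_bound (s : ℝ) (hs : |s| ≤ 1 / 4) :
    Real.exp (-s) * (√(1 - 2 * s))⁻¹ ≤ Real.exp (2 * s ^ 2) := by
  obtain ⟨h1, h2⟩ := abs_le.1 hs
  have h0 : (0:ℝ) < 1 - 2 * s := by linarith
  rw [← div_eq_mul_inv, div_le_iff₀ (Real.sqrt_pos.2 h0)]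
  have key : 1 ≤ (1 - 2 * s) * Real.exp (2 * s + 4 * s ^ 2) := by
    rcases le_total s 0 with h | h
    · have := Real.add_one_le_exp (2 * s + 4 * s ^ 2)
      nlinarith [mul_le_mul_of_nonneg_left this h0.le, mul_nonneg (sq_nonneg s) (neg_nonneg.2 h)]
    · have := Real.quadratic_le_exp_of_nonneg (x := 2 * s + 4 * s ^ 2) (by positivity)
      refine le_trans ?_ (mul_le_mul_of_nonneg_left this h0.le)
      have : (1 - 2 * s) * (1 + (2 * s + 4 * s ^ 2) + (2 * s + 4 * s ^ 2) ^ 2 / 2) - 1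
        = s ^ 2 * (2 * (1 - 2 * s) * (1 + 2 * s) ^ 2 - 8 * s) := by ring
      have h3 : 0 ≤ 2 * (1 - 2 * s) * (1 + 2 * s) ^ 2 - 8 * s := by
        nlinarith [mul_nonneg h h0.le, mul_nonneg h (mul_nonneg h h0.le), mul_nonneg (sub_nonneg.2 h2) h]
      nlinarith [mul_nonneg (sq_nonneg s) h3]
  have k2 : 1 ≤ √(1 - 2 * s) * Real.exp (s + 2 * s ^ 2) := by
    have : √((1 - 2 * s) * Real.exp (2 * s + 4 * s ^ 2)) = √(1 - 2 * s) * Real.exp (s + 2 * s ^ 2) := by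
      rw [Real.sqrt_mul h0.le]
      congr 1
      rw [show 2 * s + 4 * s ^ 2 = (s + 2 * s ^ 2) + (s + 2 * s ^ 2) by ring, Real.exp_add,
        Real.sqrt_mul_self (Real.exp_pos _).le]
    rw [← this]
    exact Real.one_le_sqrt.2 key
  calc Real.exp (-s) = Real.exp (-s) * 1 := by ring
    _ ≤ Real.exp (-s) * (√(1 - 2 * s) * Real.exp (s + 2 * s ^ 2)) := by gcongr
    _ = Real.exp (2 * s ^ 2) * √(1 - 2 * s) := by
      rw [show Real.exp (2 * s ^ 2) = Real.exp (-s) * Real.exp (s + 2 * s ^ 2) by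
        rw [← Real.exp_add]; congr 1; ring]
      ring

lemma gauss_eq (d : ℕ) : gauss d 0 1 =
    volume.withDensity fun x : Fin d → ℝ => ENNReal.ofReal (∏ i, phi (x i)) := by
  unfold gauss
  congr 1
  ext x
  congr 1
  unfold phi
  rw [Finset.prod_mul_distrib, ← Real.exp_sum, Finset.prod_const, ← Finset.mul_sum]
  simp only [sub_zero, inv_one, one_mulVec, det_one, mul_one, Finset.card_univ, Fintype.card_fin]
  congr 1
  · rw [inv_pow]
    congr 1
    rw [Real.sqrt_eq_iff_mul_self_eq (by positivity) (by positivity), ← mul_pow, 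
      Real.mul_self_sqrt (by positivity)]
  · simp [dotProduct, sq]

lemma gauss_lint (d : ℕ) (F : (Fin d → ℝ) → ℝ) (hF : Measurable F) :
    ∫⁻ x, ENNReal.ofReal (F x) ∂(gauss d 0 1) = ∫⁻ x, ENNReal.ofReal ((∏ i, phi (x i)) * F x) := by
  rw [gauss_eq, lintegral_withDensity_eq_lintegral_mul]
  · refine lintegral_congr fun x => ?_
    rw [Pi.mul_apply, ENNReal.ofReal_mul]
    exact Finset.prod_nonneg fun i _ => phi_nonneg _
  · exact ENNReal.measurable_ofReal.comp
      (Finset.measurable_prod _ fun i _ => phi_meas.comp (measurable_pi_apply i))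
  · exact ENNReal.measurable_ofReal.comp hF

instance gauss_prob (d : ℕ) : IsProbabilityMeasure (gauss d 0 1) := by
  constructor
  have h := gauss_lint d (fun _ => 1) measurable_const
  simp only [ENNReal.ofReal_one, lintegral_const, one_mul, mul_one] at h
  rw [h]
  simp_rw [ENNReal.ofReal_prod_of_nonneg (fun i _ => phi_nonneg _)]
  rw [volume_pi, lint_pi d (fun _ => volume) (fun _ x => ENNReal.ofReal (phi x))
    (fun _ => ENNReal.measurable_ofReal.comp phi_meas)]
  have := one_d 0 (by norm_num)
  simp only [zero_mul, Real.exp_zero, mul_one, neg_zero, mul_zero, sub_zero, Real.sqrt_one, inv_one, ENNReal.ofReal_one] at this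
  simp [this]

lemma spec {d : ℕ} (Q : Matrix (Fin d) (Fin d) ℝ) (h : Q.IsSymm) :
    ∃ U : Matrix (Fin d) (Fin d) ℝ, ∃ μ : Fin d → ℝ, Uᵀ * U = 1 ∧ U * Uᵀ = 1 ∧
      Q = U * diagonal μ * Uᵀ ∧ Q.rank = Fintype.card {i // μ i ≠ 0} := by
  have hH : Q.IsHermitian := by
    rw [Matrix.IsHermitian, conjTranspose_eq_transpose_of_trivial]; exact h
  have hs := hH.spectral_theorem
  refine ⟨hH.eigenvectorUnitary, hH.eigenvalues, ?_, ?_, ?_, hH.rank_eq_card_non_zero_eigs⟩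
  · have := Unitary.coe_star_mul_self hH.eigenvectorUnitary
    simpa [star_eq_conjTranspose] using this
  · have := Unitary.coe_mul_star_self hH.eigenvectorUnitary
    simpa [star_eq_conjTranspose] using this
  · rw [Unitary.conjStarAlgAut_apply] at hs
    simpa [star_eq_conjTranspose, Function.comp_def] using hs

lemma rot_lint {d : ℕ} (U : Matrix (Fin d) (Fin d) ℝ) (h : Uᵀ * U = 1)
    (G : (Fin d → ℝ) → ℝ≥0∞) (hG : Measurable G) :
    ∫⁻ x, G (U *ᵥ x) = ∫⁻ x, G x := by
  have hd : U.det * U.det = 1 := by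
    have := congrArg Matrix.det h
    simpa using this
  have hd0 : U.det ≠ 0 := fun h0 => by simp [h0] at hd
  have habs : |U.det⁻¹| = 1 := by
    rw [abs_inv, inv_eq_one]
    rcases mul_self_eq_one_iff.1 hd with h | h <;> simp [h]
  have hm := Real.map_matrix_volume_pi_eq_smul_volume_pi hd0
  rw [habs, ENNReal.ofReal_one, one_smul] at hm
  conv_rhs => rw [← hm]
  rw [lintegral_map hG]
  · simp [toLin'_apply]
  · exact (LinearMap.continuous_of_finiteDimensional _).measurable

lemma tin_quad {d : ℕ} (x : Fin d → ℝ) (U : Matrix (Fin d) (Fin d) ℝ) (μ : Fin d → ℝ)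
    (h : Uᵀ * U = 1) :
    tin (vecMulVec x x - 1) (U * diagonal μ * Uᵀ) = ∑ j, μ j * ((Uᵀ *ᵥ x) j ^ 2 - 1) := by
  have e : ∀ A B : Matrix (Fin d) (Fin d) ℝ, tin A B = (Aᵀ * B).trace := by
    intro A B
    simp only [tin, trace, diag, mul_apply, transpose_apply]
    rw [Finset.sum_comm]
  rw [e, transpose_sub, transpose_one, sub_mul, one_mul, trace_sub]
  have t1 : (U * diagonal μ * Uᵀ).trace = ∑ j, μ j := by
    rw [trace_mul_comm, ← mul_assoc, h, one_mul, trace_diagonal]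
  have t2 : ((vecMulVec x x)ᵀ * (U * diagonal μ * Uᵀ)).trace = ∑ j, μ j * (Uᵀ *ᵥ x) j ^ 2 := by
    rw [transpose_vecMulVec, vecMulVec_mul, trace_vecMulVec, dotProduct_comm, ← dotProduct_mulVec, 
      ← mulVec_mulVec, ← mulVec_mulVec, dotProduct_mulVec, ← mulVec_transpose]
    simp only [dotProduct, mulVec_diagonal]
    exact Finset.sum_congr rfl fun j _ => by ring
  rw [t1, t2, ← Finset.sum_sub_distrib]
  exact Finset.sum_congr rfl fun j _ => by ring

lemma frob_spec {d : ℕ} (U : Matrix (Fin d) (Fin d) ℝ) (μ : Fin d → ℝ)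
    (h : Uᵀ * U = 1) :
    ∑ i, ∑ j, (U * diagonal μ * Uᵀ) i j ^ 2 = ∑ j, μ j ^ 2 := by
  have e : ∀ A : Matrix (Fin d) (Fin d) ℝ, ∑ i, ∑ j, A i j ^ 2 = (Aᵀ * A).trace := by
    intro A
    simp only [trace, diag, mul_apply, transpose_apply, sq]
    rw [Finset.sum_comm]
  rw [e, transpose_mul, transpose_mul, transpose_transpose, diagonal_transpose]
  have : U * (diagonal μ * Uᵀ) * (U * diagonal μ * Uᵀ) = U * (diagonal μ * diagonal μ) * Uᵀ := by
    calc _ = U * (diagonal μ * (Uᵀ * U) * diagonal μ) * Uᵀ := by simp only [mul_assoc]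
      _ = _ := by rw [h, mul_one]
  rw [this, trace_mul_comm, ← mul_assoc, h, one_mul, diagonal_mul_diagonal, trace_diagonal]
  simp [sq]

lemma tin_meas {d : ℕ} (Q : Matrix (Fin d) (Fin d) ℝ) :
    Measurable fun x : Fin d → ℝ => tin (vecMulVec x x - 1) Q := by
  unfold tin
  simp only [Matrix.sub_apply, vecMulVec_apply]
  fun_prop

lemma mgf_bound {d : ℕ} (Q : Matrix (Fin d) (Fin d) ℝ) (hQ : Q.IsSymm)
    (hn : ∑ i, ∑ j, Q i j ^ 2 ≤ 1 / 16) :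
    ∫⁻ x, ENNReal.ofReal (Real.exp (tin (vecMulVec x x - 1) Q)) ∂(gauss d 0 1) ≤
      ENNReal.ofReal (Real.exp (2 * ∑ i, ∑ j, Q i j ^ 2)) := by
  rw [gauss_lint d (fun x => Real.exp (tin (vecMulVec x x - 1) Q)) (Real.measurable_exp.comp (tin_meas Q))]
  obtain ⟨U, μ, h1, h2, rfl, -⟩ := spec Q hQ
  rw [frob_spec U μ h1] at hn ⊢
  have hμ : ∀ j, |μ j| ≤ 1 / 4 := by
    intro j
    have := Finset.single_le_sum (f := fun j => μ j ^ 2) (fun i _ => sq_nonneg _) (Finset.mem_univ j)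
    apply abs_le_of_sq_le_sq _ (by norm_num)
    linarith
  have hphi : ∀ x : Fin d → ℝ, ∏ i, phi (x i) = ∏ i, phi ((Uᵀ *ᵥ x) i) := by
    intro x
    unfold phi
    rw [Finset.prod_mul_distrib, Finset.prod_mul_distrib, ← Real.exp_sum, ← Real.exp_sum,
      ← Finset.mul_sum, ← Finset.mul_sum]
    congr 3
    have : (Uᵀ *ᵥ x) ⬝ᵥ (Uᵀ *ᵥ x) = x ⬝ᵥ x := by
      rw [dotProduct_mulVec, vecMul_transpose, mulVec_mulVec, h2, one_mulVec]
    simpa [dotProduct, sq] using this.symm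
  have e : ∀ x : Fin d → ℝ, (∏ i, phi (x i)) * Real.exp (tin (vecMulVec x x - 1) (U * diagonal μ * Uᵀ))
     = (fun y : Fin d → ℝ => ∏ j, (phi (y j) * Real.exp (μ j * (y j ^ 2 - 1)))) (Uᵀ *ᵥ x) := by
    intro x
    rw [hphi, tin_quad x U μ h1, Real.exp_sum, ← Finset.prod_mul_distrib]
  have hm : ∀ j, Measurable fun y : ℝ => ENNReal.ofReal (phi y * Real.exp (μ j * (y ^ 2 - 1))) := by
    intro j
    have := phi_meas
    fun_prop
  have hnn : ∀ j (y : ℝ), 0 ≤ phi y * Real.exp (μ j * (y ^ 2 - 1)) := fun j y =>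
    mul_nonneg (phi_nonneg _) (Real.exp_pos _).le
  simp_rw [e]
  rw [rot_lint Uᵀ (by rw [transpose_transpose, h2]) 
    (fun y => ENNReal.ofReal (∏ j, (phi (y j) * Real.exp (μ j * (y j ^ 2 - 1)))))]
  swap
  · have := phi_meas
    fun_prop
  simp_rw [ENNReal.ofReal_prod_of_nonneg (fun i _ => hnn i _)]
  rw [volume_pi, lint_pi d (fun _ => volume) 
    (fun j y => ENNReal.ofReal (phi y * Real.exp (μ j * (y ^ 2 - 1)))) hm]
  rw [Finset.mul_sum, Real.exp_sum, ENNReal.ofReal_prod_of_nonneg (fun i _ => (Real.exp_pos _).le)]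
  refine Finset.prod_le_prod' fun j _ => ?_
  rw [one_d _ (by linarith [(abs_le.1 (hμ j)).2])]
  exact ENNReal.ofReal_le_ofReal (one_d_bound _ (hμ j))

lemma chernoff {d n : ℕ} (Q : Matrix (Fin d) (Fin d) ℝ) (hQ : Q.IsSymm) (q : ℝ)
    (hq : ∑ i, ∑ j, Q i j ^ 2 ≤ q) (hn : q ≤ 1 / 16) (S : Finset (Fin n)) (a : ℝ) :
    (Measure.pi fun _ : Fin n => gauss d 0 1)
      {X | a ≤ ∑ i ∈ S, tin (vecMulVec (X i) (X i) - 1) Q} ≤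
      ENNReal.ofReal (Real.exp (2 * q * n - a)) := by
  set f : Fin n → (Fin d → ℝ) → ℝ≥0∞ := fun i x =>
    if i ∈ S then ENNReal.ofReal (Real.exp (tin (vecMulVec x x - 1) Q)) else 1 with hf
  have hfm : ∀ i, Measurable (f i) := by
    intro i
    by_cases h : i ∈ S
    · simp only [hf, h, if_true]
      exact ENNReal.measurable_ofReal.comp (Real.measurable_exp.comp (tin_meas Q))
    · simp only [hf, h, if_false]
      exact measurable_const
  have hq0 : 0 ≤ q := le_trans (Finset.sum_nonneg fun i _ => Finset.sum_nonneg fun j _ => sq_nonneg _) hq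
  have hprod : ∀ X : Fin n → Fin d → ℝ, ∏ i, f i (X i) =
      ENNReal.ofReal (Real.exp (∑ i ∈ S, tin (vecMulVec (X i) (X i) - 1) Q)) := by
    intro X
    rw [Real.exp_sum, ENNReal.ofReal_prod_of_nonneg (fun i _ => (Real.exp_pos _).le)]
    simp [hf, Finset.prod_ite_mem]
  have hM := mul_meas_ge_le_lintegral (μ := Measure.pi fun _ : Fin n => gauss d 0 1)
    (f := fun X => ∏ i, f i (X i))
    (Finset.measurable_prod _ fun i _ => (hfm i).comp (measurable_pi_apply i))
    (ENNReal.ofReal (Real.exp a))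
  rw [lint_pi n _ f hfm] at hM
  have h1 : ∏ i, ∫⁻ x, f i x ∂(gauss d 0 1) ≤ ENNReal.ofReal (Real.exp (2 * q * n)) := by
    have : ∀ i, ∫⁻ x, f i x ∂(gauss d 0 1) ≤ ENNReal.ofReal (Real.exp (2 * q)) := by
      intro i
      by_cases h : i ∈ S
      · simp only [hf, h, if_true]
        refine (mgf_bound Q hQ (hq.trans hn)).trans (ENNReal.ofReal_le_ofReal (Real.exp_le_exp.2 ?_))
        linarith
      · simp only [hf, h, if_false, lintegral_const, measure_univ, mul_one]
        rw [ENNReal.one_le_ofReal]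
        exact Real.one_le_exp (by positivity)
    refine (Finset.prod_le_prod' fun i _ => this i).trans ?_
    rw [Finset.prod_const, ← ENNReal.ofReal_pow (Real.exp_pos _).le, ← Real.exp_nat_mul]
    simp [mul_comm]
  have hset : {X : Fin n → Fin d → ℝ | ENNReal.ofReal (Real.exp a) ≤ ∏ i, f i (X i)} =
      {X | a ≤ ∑ i ∈ S, tin (vecMulVec (X i) (X i) - 1) Q} := by
    ext X
    simp only [Set.mem_ofPred_eq, hprod]
    rw [ENNReal.ofReal_le_ofReal_iff (Real.exp_pos _).le, Real.exp_le_exp]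
  rw [hset] at hM
  rw [Real.exp_sub, ENNReal.ofReal_div_of_pos (Real.exp_pos _)]
  rw [ENNReal.le_div_iff_mul_le (Or.inl (by simp [Real.exp_pos])) (Or.inl ENNReal.ofReal_ne_top), mul_comm]
  exact hM.trans h1

/-- grid value -/
def gval (N : ℕ) (m : Fin (2 * N + 1)) : ℝ := ((m : ℕ) - (N : ℝ)) / N

lemma gval_abs (N : ℕ) (hN : 1 ≤ N) (m : Fin (2 * N + 1)) : |gval N m| ≤ 1 := by
  have hN' : (0:ℝ) < N := by exact_mod_cast hN
  have : ((m : ℕ) : ℝ) ≤ 2 * N := by exact_mod_cast Nat.lt_succ_iff.1 m.2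
  have h0 : (0:ℝ) ≤ ((m : ℕ) : ℝ) := Nat.cast_nonneg _
  unfold gval
  rw [abs_div, abs_of_pos hN', div_le_one hN', abs_le]
  constructor <;> linarith

lemma gval_round (N : ℕ) (hN : 1 ≤ N) (x : ℝ) (hx : |x| ≤ 1) :
    ∃ m, |x - gval N m| ≤ 1 / N := by
  have hN' : (0:ℝ) < N := by exact_mod_cast hN
  obtain ⟨h1, h2⟩ := abs_le.1 hx
  have hy0 : 0 ≤ x * N + N := by nlinarith
  have hy1 : x * N + N ≤ (2 * N : ℕ) := by push_cast; nlinarith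
  refine ⟨⟨⌊x * N + N⌋₊, Nat.lt_succ_iff.2 (Nat.floor_le_of_le hy1)⟩, ?_⟩
  unfold gval
  have e : x - ((⌊x * N + N⌋₊ : ℝ) - N) / N = (x * N + N - ⌊x * N + N⌋₊) / N := by
    field_simp; ring
  simp only [e]
  rw [abs_div, abs_of_pos hN']
  gcongr
  rw [abs_le]
  have := Nat.floor_le hy0
  have := Nat.lt_floor_add_one (x * N + N)
  constructor <;> linarith

/-- net of low rank matrices -/
def netMat (N k d : ℕ) (p : (Fin k → Fin (2 * N + 1)) × (Fin k → Fin d → Fin (2 * N + 1))) :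
    Matrix (Fin d) (Fin d) ℝ :=
  Matrix.of fun a b => ∑ j, gval N (p.1 j) * gval N (p.2 j a) * gval N (p.2 j b)

lemma netMat_symm (N k d : ℕ) (p) : (netMat N k d p).IsSymm := by
  ext a b
  simp only [netMat, transpose_apply, of_apply]
  exact Finset.sum_congr rfl fun j _ => by ring

lemma low_rank {d k : ℕ} (P : Matrix (Fin d) (Fin d) ℝ) (hP : P.IsSymm) (hr : P.rank ≤ k)
    (hF : ∑ i, ∑ j, P i j ^ 2 = 1) :
    ∃ (f : Fin k → ℝ) (w : Fin k → Fin d → ℝ), (∀ j, |f j| ≤ 1) ∧ (∀ j a, |w j a| ≤ 1) ∧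
      ∀ a b, P a b = ∑ j, f j * w j a * w j b := by
  obtain ⟨U, μ, h1, h2, rfl, h3⟩ := spec P hP
  rw [frob_spec U μ h1] at hF
  have hμ : ∀ j, |μ j| ≤ 1 := by
    intro j
    have := Finset.single_le_sum (f := fun j => μ j ^ 2) (fun i _ => sq_nonneg _) (Finset.mem_univ j)
    apply abs_le_of_sq_le_sq _ (by norm_num)
    linarith
  have hU : ∀ j a, |U a j| ≤ 1 := by
    intro j a
    have e := congrFun (congrFun h1 j) j
    simp only [mul_apply, transpose_apply, one_apply_eq] at e
    have := Finset.single_le_sum (f := fun a => U a j * U a j) (fun i _ => mul_self_nonneg _) (Finset.mem_univ a)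
    apply abs_le_of_sq_le_sq _ (by norm_num)
    nlinarith
  rw [h3] at hr
  have hne : Nonempty ({i // μ i ≠ 0} ↪ Fin k) := 
    Function.Embedding.nonempty_of_card_le (by simpa using hr)
  obtain ⟨e⟩ := hne
  refine ⟨Function.extend e (fun i => μ i.1) 0, Function.extend e (fun i a => U a i.1) 0, ?_, ?_, ?_⟩
  · intro j
    by_cases h : ∃ i, e i = j
    · obtain ⟨i, rfl⟩ := h
      rw [e.injective.extend_apply]; exact hμ _
    · rw [Function.extend_apply' _ _ _ h]; simp
  · intro j a
    by_cases h : ∃ i, e i = j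
    · obtain ⟨i, rfl⟩ := h
      rw [e.injective.extend_apply]; exact hU _ _
    · rw [Function.extend_apply' _ _ _ h]; simp
  · intro a b
    rw [← Fintype.sum_of_injective e e.injective (fun i => μ i.1 * U a i.1 * U b i.1)]
    · rw [Fintype.sum_of_injective Subtype.val Subtype.val_injective _ (fun i => μ i * U a i * U b i)]
      · rw [mul_apply]
        simp only [mul_diagonal, transpose_apply]
        exact Finset.sum_congr rfl fun j _ => by ring
      · intro i hi
        have : μ i = 0 := by
          by_contra h
          exact hi ⟨⟨i, h⟩, rfl⟩
        simp [this]
      · intro i; rfl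
    · intro j hj
      rw [Function.extend_apply' _ _ _ (by simpa using hj)]; simp
    · intro i
      rw [e.injective.extend_apply, e.injective.extend_apply]

lemma net_approx {d k : ℕ} (N : ℕ) (hN : 1 ≤ N) (P : Matrix (Fin d) (Fin d) ℝ) (hP : P.IsSymm)
    (hr : P.rank ≤ k) (hF : ∑ i, ∑ j, P i j ^ 2 = 1) :
    ∃ p, ∀ a b, |P a b - netMat N k d p a b| ≤ k * (3 / N) := by
  obtain ⟨f, w, hf, hw, h⟩ := low_rank P hP hr hF
  choose l hl using fun j => gval_round N hN (f j) (hf j)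
  choose v hv using fun j a => gval_round N hN (w j a) (hw j a)
  refine ⟨(l, v), fun a b => ?_⟩
  rw [h]
  simp only [netMat, of_apply]
  rw [← Finset.sum_sub_distrib]
  refine (Finset.abs_sum_le_sum_abs _ _).trans ?_
  refine (Finset.sum_le_card_nsmul _ _ (3 / (N : ℝ)) fun j _ => ?_).trans (by simp)
  have key : ∀ x y z x' y' z' δ : ℝ, |y| ≤ 1 → |z| ≤ 1 → |x'| ≤ 1 → |y'| ≤ 1 →
      |x - x'| ≤ δ → |y - y'| ≤ δ → |z - z'| ≤ δ → |x * y * z - x' * y' * z'| ≤ 3 * δ := by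
    intro x y z x' y' z' δ hy hz hx' hy' h1 h2 h3
    have hδ : 0 ≤ δ := (abs_nonneg _).trans h1
    have e : x * y * z - x' * y' * z' = (x - x') * y * z + x' * (y - y') * z + x' * y' * (z - z') := by
      ring
    rw [e]
    have a1 : |(x - x') * y * z| ≤ δ * 1 * 1 := by
      rw [abs_mul, abs_mul]; gcongr
    have a2 : |x' * (y - y') * z| ≤ 1 * δ * 1 := by
      rw [abs_mul, abs_mul]; gcongr
    have a3 : |x' * y' * (z - z')| ≤ 1 * 1 * δ := by
      rw [abs_mul, abs_mul]; gcongr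
    have := abs_add_three ((x - x') * y * z) (x' * (y - y') * z) (x' * y' * (z - z'))
    linarith
  have := key _ _ _ _ _ _ _ (hw j a) (hw j b) (gval_abs N hN (l j)) (gval_abs N hN (v j a))
    (hl j) (hv j a) (hv j b)
  calc _ ≤ _ := this
    _ = 3 / (N : ℝ) := by ring

lemma tin_err {d : ℕ} (x : Fin d → ℝ) (M : Matrix (Fin d) (Fin d) ℝ) (η : ℝ) (h : ∀ a b, |M a b| ≤ η)
    (hη : 0 ≤ η) :
    |tin (vecMulVec x x - 1) M| ≤ η * (d * ∑ a, x a ^ 2 + d) := by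
  unfold tin
  have h1 : |∑ i, ∑ j, (vecMulVec x x - 1) i j * M i j| ≤ ∑ i, ∑ j, (|x i| * |x j| + (1 : Matrix (Fin d) (Fin d) ℝ) i j) * η := by
    refine (Finset.abs_sum_le_sum_abs _ _).trans (Finset.sum_le_sum fun i _ => ?_)
    refine (Finset.abs_sum_le_sum_abs _ _).trans (Finset.sum_le_sum fun j _ => ?_)
    rw [abs_mul, Matrix.sub_apply, vecMulVec_apply]
    have h1 : 0 ≤ (1 : Matrix (Fin d) (Fin d) ℝ) i j := by
      rw [one_apply]; split_ifs <;> norm_num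
    have : |x i * x j - (1 : Matrix (Fin d) (Fin d) ℝ) i j| ≤ |x i| * |x j| + (1 : Matrix (Fin d) (Fin d) ℝ) i j := by
      refine (abs_sub _ _).trans ?_
      rw [abs_mul, abs_of_nonneg h1]
    exact mul_le_mul this (h i j) (abs_nonneg _) (by positivity)
  refine h1.trans ?_
  have e : ∑ i, ∑ j, (|x i| * |x j| + (1 : Matrix (Fin d) (Fin d) ℝ) i j) * η = ((∑ i, |x i|) ^ 2 + d) * η := by
    simp only [← Finset.sum_mul, Finset.sum_add_distrib, ← Finset.mul_sum, one_apply]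
    simp [sq]
  rw [e, mul_comm]
  gcongr
  have := sq_sum_le_card_mul_sum_sq (s := Finset.univ) (f := fun i => |x i|)
  simpa using this

lemma tin_sub {d : ℕ} (A M M' : Matrix (Fin d) (Fin d) ℝ) : tin A (M - M') = tin A M - tin A M' := by
  simp [tin, mul_sub, Finset.sum_sub_distrib]

lemma tin_smul {d : ℕ} (A M : Matrix (Fin d) (Fin d) ℝ) (c : ℝ) : tin A (c • M) = c * tin A M := by
  simp only [tin, Matrix.smul_apply, smul_eq_mul, Finset.mul_sum]
  exact Finset.sum_congr rfl fun i _ => Finset.sum_congr rfl fun j _ => by ring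

lemma tin_id {d : ℕ} (x : Fin d → ℝ) : tin (vecMulVec x x - 1) 1 = ∑ a, x a ^ 2 - d := by
  simp [tin, one_apply, vecMulVec_apply, Finset.sum_sub_distrib, sq]

lemma subset_count (n : ℕ) :
    (((Finset.univ : Finset (Finset (Fin n))).filter
      (fun S => (1 - 0.000001 : ℝ) * n ≤ (S.card : ℝ))).card : ℝ) ≤ Real.exp (0.00004 * n) := by
  set F := (Finset.univ : Finset (Finset (Fin n))).filter
      (fun S => (1 - 0.000001 : ℝ) * n ≤ (S.card : ℝ)) with hF
  have h1 := Fintype.sum_pow_mul_eq_add_pow (Fin n) (1:ℝ) (Real.exp (-11))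
  simp only [one_pow, one_mul, Fintype.card_fin] at h1
  have h2 : (F.card : ℝ) * Real.exp (-11 * (0.000001 * n)) ≤ (1 + Real.exp (-11)) ^ n := by
    rw [← h1]
    refine le_trans ?_ (Finset.sum_le_sum_of_subset_of_nonneg (Finset.subset_univ F) 
      (fun i _ _ => by positivity))
    rw [← nsmul_eq_mul]
    refine Finset.card_nsmul_le_sum _ _ _ fun S hS => ?_
    rw [← Real.exp_nat_mul]
    apply Real.exp_le_exp.2
    have hc : S.card ≤ n := by simpa using Finset.card_le_univ S
    rw [Nat.cast_sub hc]
    have := (Finset.mem_filter.1 hS).2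
    linarith
  have h3 : Real.exp (-11) ≤ 0.00002 := by
    have : Real.exp 11 = Real.exp 1 ^ 11 := by rw [← Real.exp_nat_mul]; norm_num
    rw [Real.exp_neg, this]
    have h27 : (2.7:ℝ) ^ 11 ≤ Real.exp 1 ^ 11 := by
      gcongr
      linarith [Real.exp_one_gt_d9]
    calc (Real.exp 1 ^ 11)⁻¹ ≤ ((2.7:ℝ) ^ 11)⁻¹ := by gcongr
      _ ≤ 0.00002 := by norm_num
  have h4 : (1 + Real.exp (-11)) ^ n ≤ Real.exp (0.00002 * n) := by
    calc (1 + Real.exp (-11)) ^ n ≤ (Real.exp 0.00002) ^ n := by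
          gcongr
          have := Real.add_one_le_exp (0.00002 : ℝ)
          linarith
      _ = _ := by rw [← Real.exp_nat_mul, mul_comm]
  have h5 : (F.card : ℝ) * Real.exp (-11 * (0.000001 * n)) ≤ Real.exp (0.00002 * n) := h2.trans h4
  have h6 : (F.card : ℝ) ≤ Real.exp (0.00002 * n) / Real.exp (-11 * (0.000001 * n)) := by
    rwa [le_div_iff₀ (Real.exp_pos _)]
  rw [← Real.exp_sub] at h6
  refine h6.trans (Real.exp_le_exp.2 ?_)
  have : (0:ℝ) ≤ n := Nat.cast_nonneg _
  linarith

lemma net_count (d k : ℕ) (hk : 1 ≤ k) (hkd : k ≤ d) :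
    (Fintype.card ((Fin k → Fin (2 * (1800 * d ^ 3) + 1)) × (Fin k → Fin d → Fin (2 * (1800 * d ^ 3) + 1))) : ℝ)
      ≤ Real.exp (30 * (d * k) * Real.log (d * k + 1)) := by
  have hd : 1 ≤ d := hk.trans hkd
  have hdk : 1 ≤ d * k := Nat.mul_pos hd hk
  have hb : 2 * (1800 * d ^ 3) + 1 ≤ (d * k + 1) ^ 15 := by
    have h1 : d ≤ d * k + 1 := by nlinarith
    have h2 : 1 ≤ d ^ 3 := Nat.one_le_pow _ _ hd
    calc 2 * (1800 * d ^ 3) + 1 ≤ 2 ^ 12 * d ^ 3 := by omega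
      _ ≤ (d * k + 1) ^ 12 * (d * k + 1) ^ 3 := by gcongr; omega
      _ = _ := by ring
  have hc : Fintype.card ((Fin k → Fin (2 * (1800 * d ^ 3) + 1)) × (Fin k → Fin d → Fin (2 * (1800 * d ^ 3) + 1)))
      ≤ (d * k + 1) ^ (30 * (d * k)) := by
    simp only [Fintype.card_prod, Fintype.card_fun, Fintype.card_fin]
    rw [← pow_mul, ← pow_add]
    calc _ ≤ (2 * (1800 * d ^ 3) + 1) ^ (2 * (d * k)) := by
          apply Nat.pow_le_pow_right (by omega)
          nlinarith
      _ ≤ ((d * k + 1) ^ 15) ^ (2 * (d * k)) := by gcongr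
      _ = _ := by rw [← pow_mul]; congr 1; ring
  have hpos : (0:ℝ) < (d:ℝ) * k + 1 := by positivity
  calc _ ≤ (((d * k + 1) ^ (30 * (d * k)) : ℕ) : ℝ) := by exact_mod_cast hc
    _ = Real.exp (30 * (d * k) * Real.log (d * k + 1)) := by
      rw [mul_comm (30 * ((d:ℝ) * k)), Real.exp_mul, Real.exp_log hpos]
      have : (30 * ((d:ℝ) * k)) = ((30 * (d * k) : ℕ) : ℝ) := by push_cast; ring
      rw [this, Real.rpow_natCast]
      push_cast
      rfl

lemma det_part {d k n : ℕ} (hk : 1 ≤ k) (hkd : k ≤ d) (hn : 1 ≤ n) (X : Fin n → Fin d → ℝ)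
    (h1 : ∑ i, tin (vecMulVec (X i) (X i) - 1) ((1 / (4 * d : ℝ)) • (1 : Matrix (Fin d) (Fin d) ℝ)) < n)
    (S : Finset (Fin n))
    (h2 : ∀ p, ∑ a, ∑ b, netMat (1800 * d ^ 3) k d p a b ^ 2 ≤ 4 →
      ∑ i ∈ S, tin (vecMulVec (X i) (X i) - 1) ((1 / 200 : ℝ) • netMat (1800 * d ^ 3) k d p) < 0.00045 * n)
    (P : Matrix (Fin d) (Fin d) ℝ) (hP : P.IsSymm) (hr : P.rank ≤ k)
    (hF : ∑ a, ∑ b, P a b ^ 2 = 1) :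
    (1 / (n : ℝ)) * ∑ i ∈ S, tin (vecMulVec (X i) (X i) - 1) P ≤ 0.1 := by
  have hd : 1 ≤ d := hk.trans hkd
  have hd' : (1:ℝ) ≤ d := by exact_mod_cast hd
  have hn' : (1:ℝ) ≤ n := by exact_mod_cast hn
  have hkd' : (k:ℝ) ≤ d := by exact_mod_cast hkd
  have hN : 1 ≤ 1800 * d ^ 3 := Nat.mul_pos (by norm_num) (pow_pos hd 3)
  obtain ⟨p, hp⟩ := net_approx (k := k) (1800 * d ^ 3) hN P hP hr hF
  set η : ℝ := 1 / (600 * d ^ 2) with hη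
  have hη0 : 0 ≤ η := by positivity
  have hηd : η * d ^ 2 = 1 / 600 := by rw [hη]; field_simp
  set M := netMat (1800 * d ^ 3) k d p with hM
  have hp' : ∀ a b, |P a b - M a b| ≤ η := by
    intro a b
    refine (hp a b).trans ?_
    calc (k:ℝ) * (3 / ((1800 * d ^ 3 : ℕ) : ℝ)) ≤ d * (3 / ((1800 * d ^ 3 : ℕ) : ℝ)) := by gcongr
      _ = η := by rw [hη]; push_cast; field_simp; norm_num
  have hη1 : η * d ≤ 1 := by nlinarith
  have hM4 : ∑ a, ∑ b, M a b ^ 2 ≤ 4 := by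
    have : ∑ a, ∑ b, M a b ^ 2 ≤ ∑ a : Fin d, ∑ b : Fin d, (2 * P a b ^ 2 + 2 * η ^ 2) := by
      refine Finset.sum_le_sum fun a _ => Finset.sum_le_sum fun b _ => ?_
      have h := hp' a b
      have h' : (P a b - M a b) ^ 2 ≤ η ^ 2 := sq_le_sq' (abs_le.1 h).1 (abs_le.1 h).2
      nlinarith [sq_nonneg (2 * P a b - M a b)]
    refine this.trans ?_
    simp only [Finset.sum_add_distrib, ← Finset.mul_sum, hF, Finset.sum_const, Finset.card_univ,
      Fintype.card_fin, nsmul_eq_mul]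
    have : (η * d) ^ 2 ≤ 1 := pow_le_one₀ (by positivity) hη1
    nlinarith
  have hb := h2 p hM4
  simp only [tin_smul, ← Finset.mul_sum, tin_id] at hb h1
  have hsq : ∑ i, ∑ a, X i a ^ 2 ≤ 5 * d * n := by
    rw [Finset.sum_sub_distrib] at h1
    simp only [Finset.sum_const, Finset.card_univ, Fintype.card_fin, nsmul_eq_mul] at h1
    rw [one_div, inv_mul_lt_iff₀ (by positivity)] at h1
    linarith
  have herr : ∑ i ∈ S, tin (vecMulVec (X i) (X i) - 1) (P - M) ≤ 0.01 * n := by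
    have : ∑ i ∈ S, tin (vecMulVec (X i) (X i) - 1) (P - M) ≤
        ∑ i, η * (d * ∑ a, X i a ^ 2 + d) := by
      refine le_trans (Finset.sum_le_sum fun i _ => (le_abs_self _).trans
        (tin_err (X i) (P - M) η hp' hη0)) ?_
      refine Finset.sum_le_sum_of_subset_of_nonneg (Finset.subset_univ _) fun i _ _ => ?_
      have : 0 ≤ ∑ a, X i a ^ 2 := Finset.sum_nonneg fun _ _ => sq_nonneg _
      positivity
    refine this.trans ?_
    rw [← Finset.mul_sum, Finset.sum_add_distrib, ← Finset.mul_sum]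
    simp only [Finset.sum_const, Finset.card_univ, Fintype.card_fin, nsmul_eq_mul]
    calc η * (d * ∑ i, ∑ a, X i a ^ 2 + n * d) ≤ η * (d * (5 * d * n) + n * (d * d)) := by
          gcongr
          nlinarith
      _ = (η * d ^ 2) * 6 * n := by ring
      _ = 0.01 * n := by rw [hηd]; norm_num
  simp only [tin_sub, Finset.sum_sub_distrib] at herr
  rw [one_div, inv_mul_le_iff₀ (by positivity)]
  linarith

lemma main_bound (d k n : ℕ) (hk : 1 ≤ k) (hkd : k ≤ d)
    (hn : (n : ℝ) ≥ (d : ℝ) * k * (300000 * Real.log ((d : ℝ) * k + 1))) :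
    1 - ENNReal.ofReal (Real.exp (-0.000001 * n)) ≤
      (Measure.pi fun _ : Fin n => gauss d 0 1)
        {X : Fin n → (Fin d → ℝ) |
          ∀ P : Matrix (Fin d) (Fin d) ℝ, P.IsSymm → P.rank ≤ k → frobNorm P = 1 →
          ∀ S : Finset (Fin n), (1 - 0.000001) * n ≤ (S.card : ℝ) →
            |(1 / (n : ℝ)) * ∑ i ∈ S, tin (vecMulVec (X i) (X i) - 1) P| ≤ 0.1} := by
  have hd : 1 ≤ d := hk.trans hkd
  have hd' : (1:ℝ) ≤ d := by exact_mod_cast hd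
  have hdk : (1:ℝ) ≤ d * k := by exact_mod_cast Nat.mul_pos hd hk
  have hlog : 0.69 ≤ Real.log ((d : ℝ) * k + 1) := by
    have := Real.log_le_log (by norm_num : (0:ℝ) < 2) (by linarith : (2:ℝ) ≤ d * k + 1)
    linarith [Real.log_two_gt_d9]
  have hnbig : (200000:ℝ) ≤ n := by nlinarith
  have hn1 : 1 ≤ n := by
    have : (1:ℝ) ≤ n := by linarith
    exact_mod_cast this
  set ν := Measure.pi fun _ : Fin n => gauss d 0 1 with hν
  set A := {X : Fin n → (Fin d → ℝ) |
          ∀ P : Matrix (Fin d) (Fin d) ℝ, P.IsSymm → P.rank ≤ k → frobNorm P = 1 →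
          ∀ S : Finset (Fin n), (1 - 0.000001) * n ≤ (S.card : ℝ) →
            |(1 / (n : ℝ)) * ∑ i ∈ S, tin (vecMulVec (X i) (X i) - 1) P| ≤ 0.1} with hA
  set B1 := {X : Fin n → (Fin d → ℝ) | (n : ℝ) ≤ ∑ i, tin (vecMulVec (X i) (X i) - 1)
    ((1 / (4 * d : ℝ)) • (1 : Matrix (Fin d) (Fin d) ℝ))} with hB1
  set FS := (Finset.univ : Finset (Finset (Fin n))).filter
      (fun S => (1 - 0.000001 : ℝ) * n ≤ (S.card : ℝ)) with hFS
  classical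
  set FP := (Finset.univ : Finset ((Fin k → Fin (2 * (1800 * d ^ 3) + 1)) × 
      (Fin k → Fin d → Fin (2 * (1800 * d ^ 3) + 1)))).filter
      (fun p => ∑ a, ∑ b, netMat (1800 * d ^ 3) k d p a b ^ 2 ≤ 4) with hFP
  set B2 := fun S : Finset (Fin n) => fun p => {X : Fin n → (Fin d → ℝ) | 
    0.00045 * (n : ℝ) ≤ ∑ i ∈ S, tin (vecMulVec (X i) (X i) - 1) 
      ((1 / 200 : ℝ) • netMat (1800 * d ^ 3) k d p)} with hB2
  have hsub : Set.univ ⊆ A ∪ (B1 ∪ ⋃ S ∈ FS, ⋃ p ∈ FP, B2 S p) := by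
    intro X _
    by_cases hX : X ∈ B1 ∪ ⋃ S ∈ FS, ⋃ p ∈ FP, B2 S p
    · exact Or.inr hX
    left
    rw [Set.mem_union, not_or] at hX
    obtain ⟨hX1, hX2⟩ := hX
    have hX1' := hX1
    rw [hB1, Set.mem_ofPred_eq, not_le] at hX1'
    simp only [Set.mem_iUnion, not_exists, hB2, Set.mem_ofPred_eq, not_le] at hX2
    intro P hP hr hF S hS
    have hSF : S ∈ FS := Finset.mem_filter.2 ⟨Finset.mem_univ _, hS⟩
    have hF' : ∑ a, ∑ b, P a b ^ 2 = 1 := by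
      have := hF
      rw [frobNorm, Real.sqrt_eq_one] at this
      exact this
    have hdet := det_part hk hkd hn1 X hX1' S 
      (fun p hp => hX2 S hSF p (Finset.mem_filter.2 ⟨Finset.mem_univ _, hp⟩))
    rw [abs_le]
    constructor
    · have hneg := hdet (-P) hP.neg ?_ ?_
      · have e : ∀ x : Fin d → ℝ, tin (vecMulVec x x - 1) (-P) = - tin (vecMulVec x x - 1) P := by
          intro x; simp [tin]
        simp only [e, Finset.sum_neg_distrib, mul_neg] at hneg
        linarith
      · refine le_trans ?_ hr
        have : -P = (-1 : Matrix (Fin d) (Fin d) ℝ) * P := by simp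
        rw [this]
        exact rank_mul_le_right _ _
      · simpa using hF'
    · exact hdet P hP hr hF'
  have hm1 : ν B1 ≤ ENNReal.ofReal (Real.exp (-0.0001 * n)) := by
    refine (chernoff _ ?_ (1 / 16) ?_ le_rfl Finset.univ _).trans ?_
    · exact (Matrix.isSymm_one).smul _
    · have : ∀ i j : Fin d, ((1 / (4 * d : ℝ)) • (1 : Matrix (Fin d) (Fin d) ℝ)) i j ^ 2 =
          if i = j then (1 / (4 * d : ℝ)) ^ 2 else 0 := by
        intro i j
        rw [Matrix.smul_apply, one_apply]
        split_ifs <;> simp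
      simp only [this, Finset.sum_ite_eq, Finset.mem_univ, if_true, Finset.sum_const, 
        Finset.card_univ, Fintype.card_fin, nsmul_eq_mul]
      rw [div_pow, mul_pow, one_pow, mul_one_div, div_le_div_iff₀ (by positivity) (by norm_num)]
      nlinarith
    · apply ENNReal.ofReal_le_ofReal
      apply Real.exp_le_exp.2
      linarith
  have hm2 : ∀ S, ∀ p ∈ FP, ν (B2 S p) ≤ ENNReal.ofReal (Real.exp (-0.00025 * n)) := by
    intro S p hp
    refine (chernoff _ ?_ 0.0001 ?_ (by norm_num) S _).trans ?_
    · exact (netMat_symm _ _ _ _).smul _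
    · have := (Finset.mem_filter.1 hp).2
      simp only [Matrix.smul_apply, smul_eq_mul, mul_pow, ← Finset.mul_sum]
      linarith
    · apply ENNReal.ofReal_le_ofReal
      apply Real.exp_le_exp.2
      linarith
  have hm3 : ν (⋃ S ∈ FS, ⋃ p ∈ FP, B2 S p) ≤ ENNReal.ofReal (Real.exp (-0.0001 * n)) := by
    calc ν (⋃ S ∈ FS, ⋃ p ∈ FP, B2 S p) ≤ ∑ S ∈ FS, ν (⋃ p ∈ FP, B2 S p) :=
          measure_biUnion_finset_le _ _
      _ ≤ ∑ S ∈ FS, ∑ p ∈ FP, ν (B2 S p) := Finset.sum_le_sum fun S _ => measure_biUnion_finset_le _ _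
      _ ≤ ∑ S ∈ FS, ∑ p ∈ FP, ENNReal.ofReal (Real.exp (-0.00025 * n)) := 
          Finset.sum_le_sum fun S _ => Finset.sum_le_sum fun p hp => hm2 S p hp
      _ = ENNReal.ofReal ((FS.card : ℝ) * ((FP.card : ℝ) * Real.exp (-0.00025 * n))) := by
          simp only [Finset.sum_const, nsmul_eq_mul]
          rw [ENNReal.ofReal_mul (by positivity), ENNReal.ofReal_mul (by positivity)]
          simp
      _ ≤ _ := by
          apply ENNReal.ofReal_le_ofReal
          have c1 := subset_count n
          have c2 : (FP.card : ℝ) ≤ Real.exp (30 * (d * k) * Real.log (d * k + 1)) := by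
            refine le_trans ?_ (net_count d k hk hkd)
            exact_mod_cast Finset.card_le_univ FP
          calc (FS.card : ℝ) * ((FP.card : ℝ) * Real.exp (-0.00025 * n)) 
              ≤ Real.exp (0.00004 * n) * (Real.exp (30 * (d * k) * Real.log (d * k + 1)) * Real.exp (-0.00025 * n)) := by
                gcongr
            _ = Real.exp (0.00004 * n + (30 * (d * k) * Real.log (d * k + 1) + -0.00025 * n)) := by
                rw [Real.exp_add, Real.exp_add]
            _ ≤ Real.exp (-0.0001 * n) := by
                apply Real.exp_le_exp.2
                nlinarith
  have htot : ENNReal.ofReal (Real.exp (-0.0001 * n)) + ENNReal.ofReal (Real.exp (-0.0001 * n)) ≤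
      ENNReal.ofReal (Real.exp (-0.000001 * n)) := by
    rw [← ENNReal.ofReal_add (by positivity) (by positivity)]
    apply ENNReal.ofReal_le_ofReal
    have e : Real.exp (-0.000001 * n) = Real.exp (-0.0001 * n) * Real.exp (0.000099 * n) := by
      rw [← Real.exp_add]; congr 1; ring
    rw [e]
    have := Real.add_one_le_exp (0.000099 * (n:ℝ))
    nlinarith [Real.exp_pos (-0.0001 * (n:ℝ))]
  rw [tsub_le_iff_right]
  calc (1 : ℝ≥0∞) = ν Set.univ := by rw [measure_univ]
    _ ≤ ν (A ∪ (B1 ∪ ⋃ S ∈ FS, ⋃ p ∈ FP, B2 S p)) := measure_mono hsub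
    _ ≤ ν A + (ν B1 + ν (⋃ S ∈ FS, ⋃ p ∈ FP, B2 S p)) :=
        (measure_union_le _ _).trans (add_le_add le_rfl (measure_union_le _ _))
    _ ≤ ν A + ENNReal.ofReal (Real.exp (-0.000001 * n)) :=
        add_le_add le_rfl ((add_le_add hm1 hm3).trans htot)

/-- Lemma: uniform concentration of `⟨XᵢXᵢᵀ - I, P⟩` over large subsets and low-rank
test matrices, for standard Gaussian samples. -/
theorem frobenius_union_bound :
    ∃ c : ℝ, c ∈ Set.Ioo (0 : ℝ) 0.1 ∧ ∃ C₃ > (0 : ℝ), ∃ C₄ > (0 : ℝ),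
      ∀ d k n : ℕ, 1 ≤ k → k ≤ d →
        (n : ℝ) ≥ (d : ℝ) * k * (C₃ * Real.log ((d : ℝ) * k + 1)) ^ C₄ →
        1 - ENNReal.ofReal (Real.exp (-c * n)) ≤
          (Measure.pi fun _ : Fin n => gauss d 0 1)
            {X : Fin n → (Fin d → ℝ) |
              ∀ P : Matrix (Fin d) (Fin d) ℝ, P.IsSymm → P.rank ≤ k → frobNorm P = 1 →
              ∀ S : Finset (Fin n), (1 - c) * n ≤ (S.card : ℝ) →
                |(1 / (n : ℝ)) * ∑ i ∈ S, tin (vecMulVec (X i) (X i) - 1) P| ≤ 0.1} := by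
  refine ⟨0.000001, ⟨by norm_num, by norm_num⟩, 300000, by norm_num, 1, one_pos, ?_⟩
  intro d k n hk hkd hn
  rw [Real.rpow_one] at hn
  exact main_bound d k n hk hkd hn

end
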